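/- For every finite tree T on vertex set V and every integer r ≥ 0, there exists a partition {W_1, …, W_s} of V together with vertices c_i ∈ W_i such that for every i the induced subgraph T[W_i] is connected and d_{T[W_i]}(c_i, w) ≤ r for every w ∈ W_i, and |W_i| ≥ r + 1 holds for all indices i with at most one exception. -/

import Mathlib

/-- In a connected graph, every vertex has a parent one step closer to a given root. -/
theorem SimpleGraph.Connected.exists_parent {V : Type*} {G : SimpleGraph V} (hG : G.Connected)
    (ρ : V) :
    ∃ p : V → V, (∀ v, p v = v ∨ G.Adj (p v) v) ∧ ∀ v, G.dist ρ (p v) = G.dist ρ v - 1 := by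
  have step : ∀ v, ∃ q, (q = v ∨ G.Adj q v) ∧ G.dist ρ q = G.dist ρ v - 1 := by
    intro v
    obtain ⟨w, hw⟩ := hG.exists_walk_length_eq_dist v ρ
    rw [G.dist_comm] at hw
    cases w with
    | nil => exact ⟨ρ, Or.inl rfl, by simp⟩
    | @cons _ q _ h w =>
      refine ⟨q, Or.inr h.symm, ?_⟩
      have h₁ := SimpleGraph.dist_le w
      rw [G.dist_comm] at h₁
      have h₂ := hG.dist_triangle (u := ρ) (v := q) (w := v)
      rw [SimpleGraph.dist_eq_one_iff_adj.2 h.symm] at h₂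
      rw [SimpleGraph.Walk.length_cons] at hw
      omega
  choose p hp using step
  exact ⟨p, fun v => (hp v).1, fun v => (hp v).2⟩

/-- Iterating a map that moves vertices by at most one edge, and stays in `S`, moves by at most
`k` in the graph induced on `S`. -/
theorem SimpleGraph.edist_induce_iterate_le {V : Type*} {G : SimpleGraph V} {p : V → V}
    (hp : ∀ v, p v = v ∨ G.Adj (p v) v) (S : Set V) (k : ℕ) (w : V)
    (hS : ∀ j ≤ k, p^[j] w ∈ S) :
    (G.induce S).edist ⟨p^[k] w, hS k le_rfl⟩ ⟨w, hS 0 k.zero_le⟩ ≤ (k : ℕ∞) := by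
  induction k with
  | zero => simp
  | succ k ih =>
    refine (SimpleGraph.edist_triangle (v := ⟨p^[k] w, hS k k.le_succ⟩)).trans ?_
    rw [Nat.cast_succ, add_comm]
    refine add_le_add (ih fun j hj => hS j (hj.trans k.le_succ)) ?_
    have h := hp (p^[k] w)
    rw [← Function.iterate_succ_apply' p k w] at h
    rcases h with h | h
    · simp [h]
    · exact (SimpleGraph.edist_eq_one_iff_adj.2 (by simpa using h)).le

/-- Clustering of a rooted tree given by a parent map `p` and a depth function `d`: each vertex of
a parent-closed set `U` is sent to an ancestor at most `r` steps above it, constantly along the way,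
and every class not centred at the root has at least `r + 1` elements. -/
theorem exists_ancestor_clustering {V : Type*} [DecidableEq V] {p : V → V} {d : V → ℕ} {ρ : V}
    (hd : ∀ v, d v = 0 ↔ v = ρ) (hp : ∀ v, d (p v) = d v - 1) (r : ℕ) (U : Finset V)
    (hU : ∀ v ∈ U, p v ∈ U) :
    ∃ f : V → V, ∀ w ∈ U,
      (∃ k ≤ r, p^[k] w = f w ∧ ∀ j ≤ k, f (p^[j] w) = f w) ∧
      (f w = ρ ∨ r + 1 ≤ (U.filter fun x => f x = f w).card) := by
  classical
  have hiter : ∀ k v, d (p^[k] v) = d v - k := by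
    intro k v
    induction k with
    | zero => rfl
    | succ k ih => rw [Function.iterate_succ_apply', hp, ih]; omega
  induction U using Finset.strongInduction with
  | H U ih =>
  have hUi : ∀ k, ∀ v ∈ U, p^[k] v ∈ U := by
    intro k v hv
    induction k with
    | zero => exact hv
    | succ k ih => rw [Function.iterate_succ_apply']; exact hU _ ih
  by_cases hr : ∀ v ∈ U, d v ≤ r
  · refine ⟨fun _ => ρ, fun w hw => ⟨⟨d w, hr w hw, ?_, fun _ _ => rfl⟩, Or.inl rfl⟩⟩
    rw [← hd, hiter, Nat.sub_self]
  push Not at hr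
  obtain ⟨v₀, hv₀, hrv₀⟩ := hr
  obtain ⟨v, hv, hmax⟩ := U.exists_max_image d ⟨v₀, hv₀⟩
  have hrv : r < d v := hrv₀.trans_le (hmax v₀ hv₀)
  set u := p^[r] v with hu
  have hdu : d u = d v - r := hiter r v
  let D : Set V := {w | ∃ k, p^[k] w = u}
  have hD : ∀ j w, p^[j] w ∈ D → w ∈ D := by
    rintro j w ⟨k, hk⟩
    exact ⟨k + j, by rw [Function.iterate_add_apply, hk]⟩
  have huD : u ∈ D := ⟨0, rfl⟩
  obtain ⟨f, hf⟩ := ih (U.filter fun w => w ∉ D)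
    (Finset.filter_ssubset.2 ⟨u, hUi r v hv, not_not.2 huD⟩) (by
      intro w hw
      rw [Finset.mem_filter] at hw ⊢
      exact ⟨hU w hw.1, fun h => hw.2 (hD 1 w h)⟩)
  refine ⟨fun x => if x ∈ D then u else f x, fun w hw => ?_⟩
  by_cases hwD : w ∈ D
  · simp only [if_pos hwD]
    refine ⟨?_, Or.inr ?_⟩
    · obtain ⟨k, hk⟩ := hwD
      have h₁ := hiter k w
      have h₂ := hmax w hw
      rw [hk] at h₁
      refine ⟨k, by omega, hk, fun j hj => if_pos ⟨k - j, ?_⟩⟩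
      rw [← Function.iterate_add_apply, Nat.sub_add_cancel hj, hk]
    · rw [← Finset.card_range (r + 1)]
      refine Finset.card_le_card_of_injOn (fun j => p^[j] v) ?_ ?_
      · intro j hj
        have hj : j ≤ r := by simpa [Nat.lt_succ_iff] using hj
        have : p^[j] v ∈ D :=
          ⟨r - j, by rw [← Function.iterate_add_apply, Nat.sub_add_cancel hj]⟩
        simp [this, hUi j v hv]
      · intro i hi j hj hij
        have h := congrArg d hij
        simp only [hiter] at h
        simp only [Finset.coe_range, Set.mem_Iio] at hi hj
        omega
  · obtain ⟨⟨k, hkr, hk, hkf⟩, hcard⟩ := hf w (Finset.mem_filter.2 ⟨hw, hwD⟩)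
    simp only [if_neg hwD]
    refine ⟨⟨k, hkr, hk, fun j hj => ?_⟩, hcard.imp_right fun h => h.trans ?_⟩
    · rw [if_neg fun h => hwD (hD j w h), hkf j hj]
    · refine Finset.card_le_card fun x hx => ?_
      simp only [Finset.mem_filter] at hx ⊢
      exact ⟨hx.1.1, by rw [if_neg hx.1.2, hx.2]⟩


/-- every finite tree `T` can be partitioned, for each integer
`r ≥ 0`, into parts `Wᵢ` with centers `cᵢ ∈ Wᵢ` such that each induced subgraph
`T[Wᵢ]` is connected, every vertex of `Wᵢ` is within distance `r` of `cᵢ` inside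
`T[Wᵢ]`, and `|Wᵢ| ≥ r + 1` holds for all indices with at most one exception
(expressed here by: among any two distinct indices, at least one satisfies the
size bound). -/
theorem tree_radius_partition
    {V : Type*} [Fintype V] (T : SimpleGraph V) (hT : T.IsTree) (r : ℕ) :
    ∃ (s : ℕ) (W : Fin s → Set V) (c : ∀ i, ↥(W i)),
      (∀ i, (W i).Nonempty) ∧
      (Pairwise fun i j => Disjoint (W i) (W j)) ∧
      (⋃ i, W i) = Set.univ ∧
      (∀ i, (T.induce (W i)).Connected) ∧
      (∀ i, ∀ w : W i, (T.induce (W i)).edist (c i) w ≤ (r : ℕ∞)) ∧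
      (∀ i j, i ≠ j → r + 1 ≤ (W i).ncard ∨ r + 1 ≤ (W j).ncard) := by
  classical
  obtain ⟨ρ⟩ := hT.connected.nonempty
  obtain ⟨p, hp, hpd⟩ := hT.connected.exists_parent ρ
  obtain ⟨f, hf⟩ := exists_ancestor_clustering (d := T.dist ρ) (ρ := ρ)
    (fun v => by rw [hT.connected.dist_eq_zero_iff, eq_comm]) hpd r Finset.univ (by simp)
  have hff : ∀ w, f (f w) = f w := by
    intro w
    obtain ⟨⟨k, -, hk, hkf⟩, -⟩ := hf w (Finset.mem_univ w)
    exact hk ▸ hkf k le_rfl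
  let e := (Fintype.equivFin (Set.range f)).symm
  have hfe : ∀ i, f (e i) = e i := by
    intro i
    obtain ⟨w, hw⟩ := (e i).2
    rw [← hw, hff]
  let W : Fin (Fintype.card (Set.range f)) → Set V := fun i => {x | f x = e i}
  have hdist : ∀ i, ∀ w : W i, (T.induce (W i)).edist ⟨e i, hfe i⟩ w ≤ (r : ℕ∞) := by
    rintro i ⟨w, hw⟩
    obtain ⟨⟨k, hkr, hk, hkf⟩, -⟩ := hf w (Finset.mem_univ w)
    have h := SimpleGraph.edist_induce_iterate_le hp (W i) k w fun j hj => (hkf j hj).trans hw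
    have hki : p^[k] w = e i := hk.trans hw
    simp only [hki] at h
    exact h.trans (by exact_mod_cast hkr)
  refine ⟨_, W, fun i => ⟨e i, hfe i⟩, fun i => ⟨e i, hfe i⟩, ?_, ?_, ?_, hdist, ?_⟩
  · intro i j hij
    refine Set.disjoint_left.2 fun x hi hj => hij (e.injective (Subtype.ext ?_))
    exact Eq.trans (Eq.symm hi) hj
  · refine Set.eq_univ_of_forall fun x => Set.mem_iUnion.2 ⟨e.symm ⟨f x, x, rfl⟩, ?_⟩
    simp [W]
  · intro i
    have hreach : ∀ w : W i, (T.induce (W i)).Reachable ⟨e i, hfe i⟩ w := fun w =>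
      SimpleGraph.edist_ne_top_iff_reachable.1 ((hdist i w).trans_lt (ENat.natCast_lt_top r)).ne
    exact (SimpleGraph.connected_iff _).2
      ⟨fun a b => (hreach a).symm.trans (hreach b), ⟨⟨e i, hfe i⟩⟩⟩
  · have hsize : ∀ i, (e i : V) ≠ ρ → r + 1 ≤ (W i).ncard := by
      intro i hi
      have h := (hf (e i) (Finset.mem_univ _)).2
      rw [hfe] at h
      rw [Set.ncard_eq_toFinset_card']
      simpa [W] using h.resolve_left hi
    intro i j hij
    by_cases hi : (e i : V) = ρ
    · exact Or.inr (hsize j fun hj => hij (e.injective (Subtype.ext (hi.trans hj.symm))))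
    · exact Or.inl (hsize i hi)
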